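/- Let f : ℝ₊ → ℝ₊ be a strictly increasing continuous function, let K be a symmetric convex body in ℝⁿ, and let N ≥ n. Then E f(V_{K,N}) ≥ E f(V_{B₂ⁿ,N}), where B₂ⁿ is the Euclidean unit ball in ℝⁿ. That is, among all symmetric convex bodies, every strictly increasing continuous moment functional of the normalized volume of a symmetric random polytope on N independent uniform points is minimized by the Euclidean ball. -/

import Mathlib

open MeasureTheory Pointwise

/-- The uniform probability measure on a set `K` in `ℝⁿ`. -/
noncomputable def unifMeasure (n : ℕ) (K : Set (EuclideanSpace ℝ (Fin n))) :
    Measure (EuclideanSpace ℝ (Fin n)) :=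
  (volume K)⁻¹ • volume.restrict K

/-- The joint distribution of `N` independent uniform random points in `K`. -/
noncomputable def jointUnif (n N : ℕ) (K : Set (EuclideanSpace ℝ (Fin n))) :
    Measure (Fin N → EuclideanSpace ℝ (Fin n)) :=
  Measure.pi fun _ => unifMeasure n K

/-- `V_{K,N}`: the volume of the symmetric convex hull `conv{±x 0, …, ±x (N-1)}`,
normalized by the volume of `K`. -/
noncomputable def randSymPolyVol (n N : ℕ) (K : Set (EuclideanSpace ℝ (Fin n)))
    (x : Fin N → EuclideanSpace ℝ (Fin n)) : ℝ :=
  (volume (convexHull ℝ (Set.range x ∪ -Set.range x))).toReal / (volume K).toReal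

section

open Set Filter Topology ENNReal

/-- One-dimensional Brunn–Minkowski inequality. -/
theorem volume_add_le_of_add_mem {A B C : Set ℝ} (hA : MeasurableSet A) (hB : MeasurableSet B)
    (hAne : A.Nonempty) (hBne : B.Nonempty) (h : ∀ a ∈ A, ∀ b ∈ B, a + b ∈ C) :
    volume A + volume B ≤ volume C := by
  have key : ∀ A' ⊆ A, IsCompact A' → ∀ B' ⊆ B, IsCompact B' → A'.Nonempty → B'.Nonempty →
      volume A' + volume B' ≤ volume C := by
    intro A' hA' hA'c B' hB' hB'c hA'n hB'n
    obtain ⟨M, hM, hM'⟩ := hA'c.exists_isGreatest hA'n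
    obtain ⟨m, hm, hm'⟩ := hB'c.exists_isLeast hB'n
    have h1 : volume ((fun x => x + -m) ⁻¹' A') = volume A' := measure_preimage_add_right _ _ _
    have h2 : volume ((fun x => x + -M) ⁻¹' B') = volume B' := measure_preimage_add_right _ _ _
    have hmeas : MeasurableSet ((fun x => x + -M) ⁻¹' B') :=
      hB'c.measurableSet.preimage (by fun_prop)
    rw [← h1, ← h2, ← measure_union₀ hmeas.nullMeasurableSet]
    · apply measure_mono
      rintro x (hx | hx)
      · have := h _ (hA' hx) _ (hB' hm)
        simpa using this
      · have := h _ (hA' hM) _ (hB' hx)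
        simpa using this
    · refine measure_mono_null (t := {M + m}) ?_ (by simp)
      rintro x ⟨hx1, hx2⟩
      have h3 := hM' hx1
      have h4 := hm' hx2
      simp only [mem_singleton_iff]
      linarith
  obtain ⟨a, ha⟩ := hAne
  obtain ⟨b, hb⟩ := hBne
  rw [hA.measure_eq_iSup_isCompact, hB.measure_eq_iSup_isCompact]
  simp only [iSup_and']
  refine ENNReal.biSup_add_biSup_le' ⟨∅, by simp⟩ ⟨∅, by simp⟩ fun A' hA' B' hB' => ?_
  refine le_trans ?_ (key (insert a A') (insert_subset ha hA'.1) (hA'.2.insert a)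
    (insert b B') (insert_subset hb hB'.1) (hB'.2.insert b) (insert_nonempty _ _)
    (insert_nonempty _ _))
  gcongr <;> exact subset_insert _ _

theorem prekopa_leindler_real {f g h : ℝ → ℝ} {k : ℝ} (hf : Measurable f) (hg : Measurable g)
    (hh : Measurable h) (hf0 : ∀ x, 0 ≤ f x) (hg0 : ∀ x, 0 ≤ g x) (hh0 : ∀ x, 0 ≤ h x)
    (hfk : ∀ x, f x ≤ k) (hgk : ∀ x, g x ≤ k) (H : ∀ x y, f x * g y ≤ h (x + y) ^ 2) :
    4 * (∫⁻ x, .ofReal (f x)) * ∫⁻ x, .ofReal (g x) ≤ (∫⁻ x, .ofReal (h x)) ^ 2 := by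
  have hfb : BddAbove (range f) := ⟨k, by rintro _ ⟨x, rfl⟩; exact hfk x⟩
  have hgb : BddAbove (range g) := ⟨k, by rintro _ ⟨x, rfl⟩; exact hgk x⟩
  set a := ⨆ x, f x with ha
  set b := ⨆ x, g x with hb
  have hfa : ∀ x, f x ≤ a := le_ciSup hfb
  have hgb : ∀ x, g x ≤ b := le_ciSup hgb
  have ha0 : 0 ≤ a := (hf0 0).trans (hfa 0)
  have hb0 : 0 ≤ b := (hg0 0).trans (hgb 0)
  rcases ha0.eq_or_lt with ha1 | ha1
  · have : ∀ x, f x = 0 := fun x => le_antisymm (ha1 ▸ hfa x) (hf0 x)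
    simp [this]
  rcases hb0.eq_or_lt with hb1 | hb1
  · have : ∀ x, g x = 0 := fun x => le_antisymm (hb1 ▸ hgb x) (hg0 x)
    simp [this]
  set c := √(a * b) with hc
  have hc0 : 0 < c := by positivity
  have hc2 : c ^ 2 = a * b := Real.sq_sqrt (by positivity)
  have layer : ∀ (u : ℝ → ℝ) (s : ℝ), Measurable u → (∀ x, 0 ≤ u x) → 0 < s →
      ∫⁻ x, .ofReal (u x) = .ofReal s * ∫⁻ t in Ioi (0 : ℝ), volume {x | t * s < u x} := by
    intro u s hu hu0 hs
    have h1 : ∫⁻ x, .ofReal (u x) = .ofReal s * ∫⁻ x, .ofReal (u x / s) := by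
      rw [← lintegral_const_mul _ (by fun_prop)]
      congr with x
      rw [← ENNReal.ofReal_mul hs.le]
      congr 1
      field_simp
    rw [h1, lintegral_eq_lintegral_meas_lt _ (ae_of_all _ fun x => div_nonneg (hu0 x) hs.le)
      (by fun_prop)]
    simp only [lt_div_iff₀ hs]
  have meas : ∀ (u : ℝ → ℝ) (s : ℝ), 0 < s →
      Measurable fun t : ℝ => volume {x | t * s < u x} := by
    intro u s hs
    refine Antitone.measurable fun t t' htt' => measure_mono fun x (hx : t' * s < u x) => ?_
    exact lt_of_le_of_lt (by gcongr) hx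
  have main : (∫⁻ t in Ioi (0 : ℝ), volume {x | t * a < f x}) +
      (∫⁻ t in Ioi (0 : ℝ), volume {x | t * b < g x}) ≤
      ∫⁻ t in Ioi (0 : ℝ), volume {x | t * c < h x} := by
    rw [← lintegral_add_left (meas _ _ ‹_›)]
    refine setLIntegral_mono (meas _ _ ‹_›) fun t (ht : 0 < t) => ?_
    rcases lt_or_ge t 1 with ht1 | ht1
    · apply volume_add_le_of_add_mem
      · exact measurableSet_lt (by fun_prop) hf
      · exact measurableSet_lt (by fun_prop) hg
      · exact exists_lt_of_lt_ciSup (mul_lt_of_lt_one_left ‹_› ht1)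
      · exact exists_lt_of_lt_ciSup (mul_lt_of_lt_one_left ‹_› ht1)
      · intro x hx y hy
        simp only [mem_ofPred_eq] at hx hy ⊢
        refine lt_of_pow_lt_pow_left₀ 2 (hh0 _) (lt_of_lt_of_le ?_ (H x y))
        rw [mul_pow, hc2]
        have := mul_lt_mul'' hx hy (by positivity) (by positivity)
        linarith
    · have h1 : {x | t * a < f x} = ∅ := by
        ext x; simp only [mem_ofPred_eq, mem_empty_iff_false, iff_false, not_lt]
        nlinarith [hfa x]
      have h2 : {x | t * b < g x} = ∅ := by
        ext x; simp only [mem_ofPred_eq, mem_empty_iff_false, iff_false, not_lt]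
        nlinarith [hgb x]
      simp [h1, h2]
  rw [layer f a hf hf0 ha1, layer g b hg hg0 hb1, layer h c hh hh0 hc0]
  generalize (∫⁻ t in Ioi (0 : ℝ), volume {x | t * a < f x}) = p at main ⊢
  generalize (∫⁻ t in Ioi (0 : ℝ), volume {x | t * b < g x}) = q at main ⊢
  have hpq : 4 * p * q ≤ (p + q) ^ 2 := by
    by_cases hp : p = ∞
    · simp [hp]
    by_cases hq : q = ∞
    · simp [hq]
    lift p to NNReal using hp
    lift q to NNReal using hq
    norm_cast
    exact four_mul_le_sq_add p q
  calc 4 * (ENNReal.ofReal a * p) * (ENNReal.ofReal b * q)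
      = (ENNReal.ofReal a * ENNReal.ofReal b) * (4 * p * q) := by ring
    _ = ENNReal.ofReal c ^ 2 * (4 * p * q) := by
      rw [← ENNReal.ofReal_mul ha0, ← hc2, ENNReal.ofReal_pow hc0.le]
    _ ≤ ENNReal.ofReal c ^ 2 * (p + q) ^ 2 := by gcongr
    _ ≤ _ := by rw [← mul_pow]; gcongr

theorem prekopa_leindler_one {f g h : ℝ → ℝ≥0∞} (hf : Measurable f) (hg : Measurable g)
    (hh : Measurable h) (H : ∀ x y, f x * g y ≤ h (x + y) ^ 2) :
    4 * (∫⁻ x, f x) * ∫⁻ x, g x ≤ (∫⁻ x, h x) ^ 2 := by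
  have key : ∀ k : ℕ, 4 * (∫⁻ x, min (f x) k) * ∫⁻ x, min (g x) k ≤ (∫⁻ x, h x) ^ 2 := by
    intro k
    have e : ∀ (u : ℝ → ℝ≥0∞) x, ENNReal.ofReal (min (u x) k).toReal = min (u x) k := fun u x =>
      ENNReal.ofReal_toReal (ne_of_lt (lt_of_le_of_lt (min_le_right _ _) (by simp)))
    have b : ∀ (u : ℝ → ℝ≥0∞) x, (min (u x) k).toReal ≤ k := fun u x =>
      ENNReal.toReal_le_of_le_ofReal (by simp) (by simp)
    have := prekopa_leindler_real (f := fun x => (min (f x) k).toReal)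
      (g := fun x => (min (g x) k).toReal) (h := fun x => (min (h x) k).toReal) (k := k)
      (by fun_prop) (by fun_prop) (by fun_prop) (fun _ => toReal_nonneg) (fun _ => toReal_nonneg)
      (fun _ => toReal_nonneg) (b f) (b g) (by
        intro x y
        rw [← ENNReal.toReal_mul, ← ENNReal.toReal_pow]
        refine ENNReal.toReal_mono ?_ ?_
        · exact ENNReal.pow_ne_top (ne_of_lt (lt_of_le_of_lt (min_le_right _ _) (by simp)))
        · rcases min_cases (h (x + y)) (k : ℝ≥0∞) with ⟨h1, _⟩ | ⟨h1, _⟩ <;> rw [h1]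
          · exact (mul_le_mul' (min_le_left _ _) (min_le_left _ _)).trans (H x y)
          · rw [sq]; exact mul_le_mul' (min_le_right _ _) (min_le_right _ _))
    simp only [e] at this
    exact this.trans (by gcongr; exact min_le_left _ _)
  have lim : ∀ u : ℝ → ℝ≥0∞, Measurable u →
      Tendsto (fun k : ℕ => ∫⁻ x, min (u x) k) atTop (𝓝 (∫⁻ x, u x)) := by
    intro u hu
    refine lintegral_tendsto_of_tendsto_of_monotone (fun k => by fun_prop) ?_ ?_
    · exact ae_of_all _ fun x i j hij => by dsimp; gcongr
    · refine ae_of_all _ fun x => ?_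
      simpa using (tendsto_const_nhds (x := u x)).min ENNReal.tendsto_nat_nhds_top
  by_cases hf0 : ∫⁻ x, f x = 0
  · simp [hf0]
  by_cases hg0 : ∫⁻ x, g x = 0
  · simp [hg0]
  refine le_of_tendsto' (ENNReal.Tendsto.mul (ENNReal.Tendsto.const_mul (lim f hf) ?_) ?_
    (lim g hg) ?_) key
  · exact Or.inl hf0
  · left; simp [hf0]
  · exact Or.inl hg0

/-- A midpoint form of the Prékopa–Leindler inequality. -/
theorem prekopa_leindler {n : ℕ} {f g h : (Fin n → ℝ) → ℝ≥0∞} (hf : Measurable f)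
    (hg : Measurable g) (hh : Measurable h) (H : ∀ x y, f x * g y ≤ h (x + y) ^ 2) :
    4 ^ n * (∫⁻ x, f x) * ∫⁻ x, g x ≤ (∫⁻ x, h x) ^ 2 := by
  induction n with
  | zero =>
    have h0 := H default default
    simp only [volume_pi, Measure.pi_of_empty _ (default : Fin 0 → ℝ), lintegral_dirac,
      pow_zero, one_mul]
    rwa [Subsingleton.elim (default + default) (default : Fin 0 → ℝ)] at h0
  | succ n ih =>
    let e := (MeasurableEquiv.piFinSuccAbove (fun _ : Fin (n + 1) => ℝ) 0).symm
    have he : MeasurePreserving e := (volume_preserving_piFinSuccAbove (fun _ => ℝ) 0).symm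
    have split : ∀ u : (Fin (n + 1) → ℝ) → ℝ≥0∞, Measurable u →
        ∫⁻ x, u x = ∫⁻ s, ∫⁻ y, u (e (s, y)) := by
      intro u hu
      rw [← he.lintegral_comp hu, Measure.volume_eq_prod, lintegral_prod _ (by fun_prop)]
    have m : ∀ u : (Fin (n + 1) → ℝ) → ℝ≥0∞, Measurable u →
        Measurable fun s => ∫⁻ y, u (e (s, y)) := fun u hu =>
      Measurable.lintegral_prod_right' (f := fun p => u (e p)) (by fun_prop)
    rw [split f hf, split g hg, split h hh]
    have := prekopa_leindler_one (f := fun s => 2 ^ n * ∫⁻ y, f (e (s, y)))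
      (g := fun s => 2 ^ n * ∫⁻ y, g (e (s, y))) (h := fun s => ∫⁻ y, h (e (s, y)))
      ((m f hf).const_mul _) ((m g hg).const_mul _) (m h hh) (by
        intro s s'
        refine le_trans (le_of_eq ?_) (ih (f := fun y => f (e (s, y))) (g := fun y => g (e (s', y)))
          (h := fun y => h (e (s + s', y))) (by fun_prop) (by fun_prop) (by fun_prop) ?_)
        · rw [show (4 : ℝ≥0∞) ^ n = 2 ^ n * 2 ^ n by rw [← mul_pow]; norm_num]
          ring
        · intro x y
          refine (H _ _).trans (le_of_eq ?_)
          congr 2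
          ext i
          refine Fin.cases ?_ (fun j => ?_) i <;>
            simp [e, MeasurableEquiv.piFinSuccAbove, Fin.insertNthEquiv])
    rw [lintegral_const_mul _ (m f hf), lintegral_const_mul _ (m g hg)] at this
    refine le_trans (le_of_eq ?_) this
    rw [pow_succ, show (4 : ℝ≥0∞) ^ n = 2 ^ n * 2 ^ n by rw [← mul_pow]; norm_num]
    ring

/-- Translating a box away from the origin decreases the volume of its intersection with a
symmetric midpoint-convex set. -/
theorem volume_inter_Icc_le_centered {N : ℕ} {C : Set (Fin N → ℝ)} (hC : MeasurableSet C)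
    (hneg : ∀ x ∈ C, -x ∈ C) (hmid : ∀ x ∈ C, ∀ y ∈ C, (1 / 2 : ℝ) • (x + y) ∈ C)
    (a b : Fin N → ℝ) :
    volume (C ∩ Icc a b) ≤
      volume (C ∩ Icc (-((1 / 2 : ℝ) • (b - a))) ((1 / 2 : ℝ) • (b - a))) := by
  set A := C ∩ Icc a b with hA
  set D := C ∩ Icc (-((1 / 2 : ℝ) • (b - a))) ((1 / 2 : ℝ) • (b - a)) with hD
  have hAm : MeasurableSet A := hC.inter measurableSet_Icc
  have hDm : MeasurableSet D := hC.inter measurableSet_Icc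
  have hD2 : MeasurableSet ((2 : ℝ) • D) := hDm.const_smul₀ 2
  have key := prekopa_leindler (f := A.indicator 1) (g := (-A).indicator 1)
    (h := ((2 : ℝ) • D).indicator 1) (measurable_one.indicator hAm)
    (measurable_one.indicator hAm.neg) (measurable_one.indicator hD2) (by
      intro x y
      by_cases hx : x ∈ A
      · by_cases hy : y ∈ -A
        · have : x + y ∈ (2 : ℝ) • D := by
            rw [mem_smul_set_iff_inv_smul_mem₀ two_ne_zero]
            rw [Set.mem_neg] at hy
            refine ⟨?_, ?_, ?_⟩
            · have := hmid _ hx.1 _ (hneg _ hy.1)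
              simpa using this
            · intro i
              have h1 := hx.2.1 i
              have h2 := hy.2.2 i
              simp at h1 h2 ⊢
              linarith
            · intro i
              have h1 := hx.2.2 i
              have h2 := hy.2.1 i
              simp at h1 h2 ⊢
              linarith
          simp [hx, hy, this]
        · rw [indicator_of_notMem hy]; simp
      · simp [hx])
  rw [lintegral_indicator_one hAm, lintegral_indicator_one hAm.neg, lintegral_indicator_one hD2,
    Measure.measure_neg, Measure.addHaar_smul] at key
  simp only [Module.finrank_fin_fun, abs_pow, abs_two] at key
  rw [ENNReal.ofReal_pow (by norm_num), mul_pow, ← pow_mul, mul_comm N, pow_mul,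
    show ENNReal.ofReal 2 ^ 2 = 4 by norm_num, mul_assoc,
    ENNReal.mul_le_mul_iff_right (by simp) (by finiteness), ← sq] at key
  exact (ENNReal.pow_le_pow_left_iff two_ne_zero).1 key

/-- The coefficient set of the symmetric convex hull: the unit ball of `ℓ¹`. -/
def crossBall (N : ℕ) : Set (Fin N → ℝ) := {l | ∑ i, |l i| ≤ 1}

/-- The symmetric convex hull of a finite family of points. -/
def absHull {N : ℕ} {V : Type*} [AddCommGroup V] [Module ℝ V] (x : Fin N → V) : Set V :=
  (fun l : Fin N → ℝ => ∑ i, l i • x i) '' crossBall N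

theorem isCompact_crossBall (N : ℕ) : IsCompact (crossBall N) := by
  refine (isCompact_Icc (a := fun _ : Fin N => (-1 : ℝ)) (b := fun _ => 1)).of_isClosed_subset
    (isClosed_le (by fun_prop) (by fun_prop)) fun l (hl : ∑ i, |l i| ≤ 1) => ?_
  have : ∀ i, |l i| ≤ 1 := fun i =>
    (Finset.single_le_sum (fun j _ => abs_nonneg (l j)) (Finset.mem_univ i)).trans hl
  exact ⟨fun i => (abs_le.1 (this i)).1, fun i => (abs_le.1 (this i)).2⟩

theorem convex_crossBall (N : ℕ) : Convex ℝ (crossBall N) := by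
  intro x hx y hy a b ha hb hab
  calc ∑ i, |(a • x + b • y) i| ≤ ∑ i, (a * |x i| + b * |y i|) := by
        refine Finset.sum_le_sum fun i _ => (abs_add_le _ _).trans (le_of_eq ?_)
        simp [abs_mul, abs_of_nonneg ha, abs_of_nonneg hb]
    _ = a * ∑ i, |x i| + b * ∑ i, |y i| := by
        rw [Finset.sum_add_distrib, Finset.mul_sum, Finset.mul_sum]
    _ ≤ a * 1 + b * 1 := by gcongr <;> assumption
    _ = 1 := by linarith

section

variable {N : ℕ} {V : Type*} [AddCommGroup V] [Module ℝ V]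

theorem convex_absHull (x : Fin N → V) : Convex ℝ (absHull x) := by
  have : absHull x = Fintype.linearCombination ℝ x '' crossBall N := by
    ext p; simp [absHull, Fintype.linearCombination_apply]
  rw [this]
  exact (convex_crossBall N).linear_image _

theorem image_absHull {W : Type*} [AddCommGroup W] [Module ℝ W] (e : V →ₗ[ℝ] W)
    (x : Fin N → V) : e '' absHull x = absHull fun i => e (x i) := by
  simp [absHull, image_image]

theorem convexHull_range_union_neg (hN : 0 < N) (x : Fin N → V) :
    convexHull ℝ (range x ∪ -range x) = absHull x := by
  apply Subset.antisymm
  · refine convexHull_min (union_subset ?_ ?_) (convex_absHull x)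
    · rintro _ ⟨i, rfl⟩
      refine ⟨Pi.single i 1, ?_, ?_⟩
      · simp [crossBall, Pi.single_apply, apply_ite abs]
      · simp [Pi.single_apply]
    · intro p hp
      obtain ⟨i, hi⟩ := hp
      refine ⟨Pi.single i (-1), ?_, ?_⟩
      · simp [crossBall, Pi.single_apply, apply_ite abs]
      · simp [Pi.single_apply, hi]
  · rintro _ ⟨l, hl, rfl⟩
    set H := convexHull ℝ (range x ∪ -range x)
    have hH : Convex ℝ H := convex_convexHull _ _
    have hp : ∀ i, x i ∈ H := fun i => subset_convexHull _ _ (Or.inl ⟨i, rfl⟩)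
    have hn : ∀ i, -x i ∈ H := fun i => subset_convexHull _ _ (Or.inr (by simp))
    have h0 : (0 : V) ∈ H := by
      have := hH (hp ⟨0, hN⟩) (hn ⟨0, hN⟩) (a := 1 / 2) (b := 1 / 2) (by norm_num) (by norm_num)
        (by norm_num)
      simpa using this
    set s := ∑ i, |l i| with hs
    have hs0 : 0 ≤ s := Finset.sum_nonneg fun i _ => abs_nonneg _
    have e : ∀ i, l i • x i = |l i| • (if 0 ≤ l i then x i else -x i) := by
      intro i
      split_ifs with h
      · rw [abs_of_nonneg h]
      · rw [abs_of_neg (not_le.1 h)]; simp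
    rcases hs0.eq_or_lt with h | h
    · have : ∀ i, l i = 0 := fun i => abs_eq_zero.1
        ((Finset.sum_eq_zero_iff_of_nonneg fun i _ => abs_nonneg _).1 h.symm i (Finset.mem_univ i))
      simpa [this] using h0
    · have := hH.smul_mem_of_zero_mem h0 (hH.centerMass_mem (t := Finset.univ)
        (w := fun i => |l i|) (z := fun i => if 0 ≤ l i then x i else -x i)
        (fun i _ => abs_nonneg _) h (fun i _ => by split_ifs; exacts [hp i, hn i])) ⟨hs0, hl⟩
      simp only [Finset.centerMass, ← hs, smul_smul, mul_inv_cancel₀ h.ne', one_smul] at this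
      simpa only [e] using this

end

theorem isCompact_absHull {N : ℕ} {V : Type*} [NormedAddCommGroup V] [NormedSpace ℝ V]
    (x : Fin N → V) : IsCompact (absHull x) :=
  (isCompact_crossBall N).image (by fun_prop)

theorem isClosed_setOf_mem_absHull (N : ℕ) (V : Type*) [NormedAddCommGroup V] [NormedSpace ℝ V] :
    IsClosed {p : (Fin N → V) × V | p.2 ∈ absHull p.1} := by
  have : CompactSpace (crossBall N) := isCompact_iff_compactSpace.1 (isCompact_crossBall N)
  have h : IsClosed {q : crossBall N × ((Fin N → V) × V) | ∑ i, q.1.1 i • q.2.1 i = q.2.2} :=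
    isClosed_eq (continuous_finsetSum _ fun i _ => Continuous.smul
      ((continuous_apply i).comp (by fun_prop)) (by fun_prop)) (by fun_prop)
  convert isClosedMap_snd_of_compactSpace _ h using 1
  ext p
  simp [absHull]

theorem measurable_volume_absHull {N : ℕ} {V : Type*} [NormedAddCommGroup V] [NormedSpace ℝ V]
    [SecondCountableTopology V] [MeasurableSpace V] [BorelSpace V] (μ : Measure V) [SFinite μ] :
    Measurable fun x : Fin N → V => μ (absHull x) :=
  measurable_measure_prodMk_left (isClosed_setOf_mem_absHull N V).measurableSet

section fibers

variable {N m : ℕ}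

local notation "Y" => Fin m → ℝ

theorem two_mul_volume_fiber_le (w : Fin N → Y) (t t' : Fin N → ℝ) (y : Y) :
    2 * volume (Prod.mk y ⁻¹' absHull fun i => (w i, ((1 / 2 : ℝ) • (t + t')) i)) ≤
      volume (Prod.mk y ⁻¹' absHull fun i => (w i, t i)) +
      volume (Prod.mk y ⁻¹' absHull fun i => (w i, t' i)) := by
  set L : Set (Fin N → ℝ) := {l | l ∈ crossBall N ∧ ∑ i, l i • w i = y} with hL
  have hLc : IsCompact L := (isCompact_crossBall N).inter_right
    (isClosed_eq (by fun_prop) (by fun_prop))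
  have hLx : Convex ℝ L := (convex_crossBall N).inter
    ((convex_singleton y).linear_preimage (Fintype.linearCombination ℝ w))
  have hfib : ∀ s : Fin N → ℝ, Prod.mk y ⁻¹' (absHull fun i => (w i, s i)) =
      (fun l => ∑ i, l i * s i) '' L := by
    intro s
    ext r
    simp only [absHull, mem_preimage, mem_image, hL, Prod.ext_iff, Prod.fst_sum, Prod.snd_sum,
      Prod.smul_mk, smul_eq_mul, mem_ofPred_eq, and_assoc]
  have hlow : ∀ s : Fin N → ℝ, ∀ l ∈ L, ∀ l' ∈ L,
      ENNReal.ofReal (∑ i, l i * s i - ∑ i, l' i * s i) ≤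
        volume (Prod.mk y ⁻¹' absHull fun i => (w i, s i)) := by
    intro s l hl l' hl'
    rw [hfib, ← Real.volume_Icc]
    apply measure_mono
    have hc : Convex ℝ ((fun l => ∑ i, l i * s i) '' L) := by
      have : (fun l => ∑ i, l i * s i) = Fintype.linearCombination ℝ s := by
        ext l; simp [Fintype.linearCombination_apply]
      rw [this]
      exact hLx.linear_image _
    exact hc.ordConnected.out (mem_image_of_mem _ hl') (mem_image_of_mem _ hl)
  rcases L.eq_empty_or_nonempty with h0 | h0
  · simp [hfib, h0]
  set s := (1 / 2 : ℝ) • (t + t') with hs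
  obtain ⟨l, hl, hl1⟩ := hLc.exists_isMaxOn h0 (f := fun l => ∑ i, l i * s i)
    (by fun_prop)
  obtain ⟨l', hl', hl1'⟩ := hLc.exists_isMinOn h0 (f := fun l => ∑ i, l i * s i)
    (by fun_prop)
  have hup : volume (Prod.mk y ⁻¹' absHull fun i => (w i, s i)) ≤
      ENNReal.ofReal (∑ i, l i * s i - ∑ i, l' i * s i) := by
    rw [hfib, ← Real.volume_Icc]
    apply measure_mono
    rintro _ ⟨l'', hl'', rfl⟩
    exact ⟨hl1' hl'', hl1 hl''⟩
  have hsum : ∀ l : Fin N → ℝ, 2 * ∑ i, l i * s i = ∑ i, l i * t i + ∑ i, l i * t' i := by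
    intro l
    rw [← Finset.sum_add_distrib, Finset.mul_sum]
    refine Finset.sum_congr rfl fun i _ => ?_
    simp [hs]; ring
  calc 2 * volume (Prod.mk y ⁻¹' absHull fun i => (w i, s i))
      ≤ 2 * ENNReal.ofReal (∑ i, l i * s i - ∑ i, l' i * s i) := by gcongr
    _ = ENNReal.ofReal ((∑ i, l i * t i - ∑ i, l' i * t i) +
          (∑ i, l i * t' i - ∑ i, l' i * t' i)) := by
      rw [show (2 : ℝ≥0∞) = ENNReal.ofReal 2 by simp, ← ENNReal.ofReal_mul (by norm_num)]
      congr 1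
      linarith [hsum l, hsum l']
    _ ≤ _ := ENNReal.ofReal_add_le.trans (add_le_add (hlow t l hl l' hl') (hlow t' l hl l' hl'))

theorem volume_absHull_prod (x : Fin N → Y × ℝ) :
    volume (absHull x) = ∫⁻ y, volume (Prod.mk y ⁻¹' absHull x) := by
  rw [Measure.volume_eq_prod, Measure.prod_apply (isCompact_absHull x).measurableSet]

/-- The volume of a symmetric random polytope is midpoint convex along a system of parallel
chords. -/
theorem two_mul_volume_absHull_le (w : Fin N → Y) (t t' : Fin N → ℝ) :
    2 * volume (absHull fun i => (w i, ((1 / 2 : ℝ) • (t + t')) i)) ≤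
      volume (absHull fun i => (w i, t i)) + volume (absHull fun i => (w i, t' i)) := by
  have hm : ∀ x : Fin N → Y × ℝ, Measurable fun y => volume (Prod.mk y ⁻¹' absHull x) :=
    fun x => measurable_measure_prodMk_left (isCompact_absHull x).measurableSet
  rw [volume_absHull_prod, volume_absHull_prod, volume_absHull_prod,
    ← lintegral_const_mul _ (hm _), ← lintegral_add_left (hm _)]
  exact lintegral_mono fun y => two_mul_volume_fiber_le w t t' y

theorem volume_absHull_neg (w : Fin N → Y) (t : Fin N → ℝ) :
    volume (absHull fun i => (w i, (-t) i)) = volume (absHull fun i => (w i, t i)) := by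
  rw [volume_absHull_prod, volume_absHull_prod]
  refine lintegral_congr fun y => ?_
  rw [← Measure.measure_neg]
  congr 1
  ext r
  simp [absHull, Prod.ext_iff, Prod.fst_sum, Prod.snd_sum, neg_eq_iff_eq_neg]

end fibers

section steiner

variable {N m : ℕ}

local notation "Y" => Fin m → ℝ

/-- Steiner symmetrization in the direction of the last factor of a product. -/
def steinerProd (M : Set (Y × ℝ)) : Set (Y × ℝ) :=
  {p | ∃ a b, (p.1, a) ∈ M ∧ (p.1, b) ∈ M ∧ p.2 = (1 / 2) * (a - b)}

theorem isCompact_steinerProd {M : Set (Y × ℝ)} (hM : IsCompact M) :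
    IsCompact (steinerProd M) := by
  have h : IsCompact ((M ×ˢ M) ∩ {q : (Y × ℝ) × (Y × ℝ) | q.1.1 = q.2.1}) :=
    (hM.prod hM).inter_right (isClosed_eq (by fun_prop) (by fun_prop))
  convert h.image (f := fun q => (q.1.1, (1 / 2) * (q.1.2 - q.2.2))) (by fun_prop) using 1
  ext ⟨y, r⟩
  constructor
  · rintro ⟨a, b, ha, hb, hr⟩
    exact ⟨((y, a), (y, b)), ⟨⟨ha, hb⟩, rfl⟩, by simp only at hr ⊢; rw [hr]⟩
  · rintro ⟨⟨⟨y1, a⟩, ⟨y2, b⟩⟩, ⟨⟨ha, hb⟩, h12⟩, h⟩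
    simp only [Prod.mk.injEq] at h
    obtain ⟨rfl, rfl⟩ := h
    obtain rfl : y1 = y2 := h12
    exact ⟨a, b, ha, hb, rfl⟩

theorem convex_steinerProd {M : Set (Y × ℝ)} (hM : Convex ℝ M) : Convex ℝ (steinerProd M) := by
  rintro ⟨y, r⟩ ⟨a, b, ha, hb, hr⟩ ⟨y', r'⟩ ⟨a', b', ha', hb', hr'⟩ c d hc hd hcd
  refine ⟨c * a + d * a', c * b + d * b', hM ha ha' hc hd hcd, hM hb hb' hc hd hcd, ?_⟩
  simp only at hr hr'
  simp [hr, hr']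
  ring

theorem neg_mem_steinerProd {M : Set (Y × ℝ)} (hM : ∀ p ∈ M, -p ∈ M) :
    ∀ p ∈ steinerProd M, -p ∈ steinerProd M := by
  rintro ⟨y, r⟩ ⟨a, b, ha, hb, hr⟩
  refine ⟨-a, -b, hM _ ha, hM _ hb, ?_⟩
  simp only at hr
  simp [hr]
  ring

theorem exists_fiber_eq_Icc {M : Set (Y × ℝ)} (hM : IsCompact M) (hMx : Convex ℝ M) (y : Y) :
    ∃ a b : ℝ, Prod.mk y ⁻¹' M = Icc a b ∧
      Prod.mk y ⁻¹' steinerProd M = Icc (-((1 / 2) * (b - a))) ((1 / 2) * (b - a)) := by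
  have hc : IsCompact (Prod.mk y ⁻¹' M) := by
    have := hM.inter_right (t := {p : Y × ℝ | p.1 = y}) (isClosed_eq (by fun_prop) (by fun_prop))
    convert this.image continuous_snd using 1
    ext r
    simp
  have hx : Convex ℝ (Prod.mk y ⁻¹' M) := by
    intro r hr r' hr' c d hc hd hcd
    have := hMx hr hr' hc hd hcd
    simpa [← add_smul, hcd] using this
  rcases (Prod.mk y ⁻¹' M).eq_empty_or_nonempty with h | h
  · refine ⟨1, 0, by simp [h], ?_⟩
    rw [Icc_eq_empty (by norm_num), eq_empty_iff_forall_notMem]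
    rintro r ⟨a, _, ha, _⟩
    exact (h ▸ ha : a ∈ (∅ : Set ℝ))
  · obtain ⟨a, ha⟩ := hc.exists_isLeast h
    obtain ⟨b, hb⟩ := hc.exists_isGreatest h
    have e : Prod.mk y ⁻¹' M = Icc a b := Subset.antisymm (fun r hr => ⟨ha.2 hr, hb.2 hr⟩)
      (hx.ordConnected.out ha.1 hb.1)
    refine ⟨a, b, e, ?_⟩
    have e' : ∀ r, (y, r) ∈ M ↔ r ∈ Icc a b := fun r => by rw [← e]; rfl
    ext r
    simp only [steinerProd, mem_preimage, mem_ofPred_eq, e', mem_Icc]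
    have hab := ha.2 hb.1
    constructor
    · rintro ⟨c, d, hc, hd, rfl⟩
      constructor <;> linarith [hc.1, hc.2, hd.1, hd.2]
    · rintro ⟨h1, h2⟩
      exact ⟨(a + b) / 2 + r, (a + b) / 2 - r, ⟨by linarith, by linarith⟩,
        ⟨by linarith, by linarith⟩, by ring⟩

theorem volume_steinerProd {M : Set (Y × ℝ)} (hM : IsCompact M) (hMx : Convex ℝ M) :
    volume (steinerProd M) = volume M := by
  rw [Measure.volume_eq_prod, Measure.prod_apply hM.measurableSet,
    Measure.prod_apply (isCompact_steinerProd hM).measurableSet]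
  refine lintegral_congr fun y => ?_
  obtain ⟨a, b, h1, h2⟩ := exists_fiber_eq_Icc hM hMx y
  rw [h1, h2, Real.volume_Icc, Real.volume_Icc]
  congr 1
  ring

theorem measurableSet_volume_absHull_le {V : Type*} [NormedAddCommGroup V] [NormedSpace ℝ V]
    [SecondCountableTopology V] [MeasureSpace V] [BorelSpace V]
    [SFinite (volume : Measure V)] {M : Set V} (hM : IsCompact M) (s : ℝ≥0∞) :
    MeasurableSet {x : Fin N → V | (∀ i, x i ∈ M) ∧ volume (absHull x) ≤ s} := by
  have h : IsClosed {x : Fin N → V | ∀ i, x i ∈ M} := by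
    have : {x : Fin N → V | ∀ i, x i ∈ M} = ⋂ i, (fun x => x i) ⁻¹' M := by ext x; simp
    rw [this]
    exact isClosed_iInter fun i => hM.isClosed.preimage (continuous_apply i)
  exact h.measurableSet.inter (measurableSet_le (measurable_volume_absHull _) measurable_const)

theorem volume_absHull_le_steinerProd {M : Set (Y × ℝ)} (hM : IsCompact M) (hMx : Convex ℝ M)
    (s : ℝ≥0∞) :
    volume {x : Fin N → Y × ℝ | (∀ i, x i ∈ M) ∧ volume (absHull x) ≤ s} ≤
      volume {x : Fin N → Y × ℝ | (∀ i, x i ∈ steinerProd M) ∧ volume (absHull x) ≤ s} := by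
  have he := (volume_measurePreserving_arrowProdEquivProdArrow Y ℝ (Fin N)).symm
  set e := (MeasurableEquiv.arrowProdEquivProdArrow Y ℝ (Fin N)).symm
  have hm := measurableSet_volume_absHull_le (N := N) hM s
  have hm' := measurableSet_volume_absHull_le (N := N) (isCompact_steinerProd hM) s
  rw [← he.measure_preimage hm.nullMeasurableSet, ← he.measure_preimage hm'.nullMeasurableSet,
    Measure.volume_eq_prod, Measure.prod_apply (e.measurable hm),
    Measure.prod_apply (e.measurable hm')]
  refine lintegral_mono fun w => ?_
  choose a b h1 h2 using fun i => exists_fiber_eq_Icc hM hMx (w i)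
  set C : Set (Fin N → ℝ) := {t | volume (absHull fun i => (w i, t i)) ≤ s} with hC
  have hCm : MeasurableSet C := by
    have : Measurable fun t : Fin N → ℝ => volume (absHull fun i => (w i, t i)) :=
      (measurable_volume_absHull volume).comp (by fun_prop)
    exact measurableSet_le this measurable_const
  have h := volume_inter_Icc_le_centered hCm (fun t ht => by
      simpa only [hC, mem_ofPred_eq, volume_absHull_neg] using ht) (fun t ht t' ht' => by
      have h3 := two_mul_volume_absHull_le w t t'
      have h4 : volume (absHull fun i => (w i, t i)) + volume (absHull fun i => (w i, t' i))
        ≤ 2 * s := by rw [two_mul]; exact add_le_add ht ht'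
      exact (ENNReal.mul_le_mul_iff_right two_ne_zero (by simp)).1 (h3.trans h4)) a b
  have e1 : ∀ (i : Fin N) (r : ℝ), (w i, r) ∈ M ↔ a i ≤ r ∧ r ≤ b i := fun i r => by
    rw [← mem_Icc, ← h1]; rfl
  have e2 : ∀ (i : Fin N) (r : ℝ), (w i, r) ∈ steinerProd M ↔
      -((1 / 2) * (b i - a i)) ≤ r ∧ r ≤ (1 / 2) * (b i - a i) := fun i r => by
    rw [← mem_Icc, ← h2]; rfl
  convert h using 2
  · ext t
    change ((∀ i, (w i, t i) ∈ M) ∧ volume (absHull fun i => (w i, t i)) ≤ s) ↔ _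
    simp only [e1, mem_inter_iff, hC, mem_ofPred_eq, mem_Icc, Pi.le_def, ← forall_and]
    tauto
  · ext t
    change ((∀ i, (w i, t i) ∈ steinerProd M) ∧ volume (absHull fun i => (w i, t i)) ≤ s) ↔ _
    simp only [e2, mem_inter_iff, hC, mem_ofPred_eq, mem_Icc, Pi.le_def, ← forall_and]
    simp only [Pi.neg_apply, Pi.smul_apply, Pi.sub_apply, smul_eq_mul]
    tauto

theorem lintegral_Icc_add_sq {a b c : ℝ} (hab : a ≤ b) (hc : 0 ≤ c) :
    ∫⁻ t in Icc a b, ENNReal.ofReal (c + t ^ 2) =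
      ENNReal.ofReal (c * (b - a) + (b ^ 3 - a ^ 3) / 3) := by
  rw [← ofReal_integral_eq_lintegral_ofReal
    ((by fun_prop : Continuous fun t : ℝ => c + t ^ 2).continuousOn.integrableOn_Icc)
    (ae_of_all _ fun t => by positivity), integral_Icc_eq_integral_Ioc,
    ← intervalIntegral.integral_of_le hab, intervalIntegral.integral_add (by simp)
    (by simp)]
  simp
  norm_num
  ring_nf

theorem lintegral_Icc_centered_le {a b c : ℝ} (hc : 0 ≤ c) :
    ∫⁻ t in Icc (-((1 / 2) * (b - a))) ((1 / 2) * (b - a)), ENNReal.ofReal (c + t ^ 2) ≤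
      ∫⁻ t in Icc a b, ENNReal.ofReal (c + t ^ 2) := by
  rcases lt_or_ge b a with hab | hab
  · rw [Icc_eq_empty (by linarith)]; simp
  · rw [lintegral_Icc_add_sq hab hc, lintegral_Icc_add_sq (by linarith) hc]
    apply ENNReal.ofReal_le_ofReal
    nlinarith [mul_nonneg (sub_nonneg.2 hab) (sq_nonneg (a + b))]

theorem eq_or_eq_neg_of_lintegral_Icc_centered_eq {a b c : ℝ} (hc : 0 ≤ c)
    (h : ∫⁻ t in Icc (-((1 / 2) * (b - a))) ((1 / 2) * (b - a)), ENNReal.ofReal (c + t ^ 2) =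
      ∫⁻ t in Icc a b, ENNReal.ofReal (c + t ^ 2)) : b ≤ a ∨ a = -b := by
  rcases lt_or_ge b a with hab | hab
  · exact Or.inl hab.le
  · rw [lintegral_Icc_add_sq hab hc, lintegral_Icc_add_sq (by linarith) hc,
      ENNReal.ofReal_eq_ofReal_iff] at h
    · have : (b - a) * (a + b) ^ 2 = 0 := by linarith
      rcases mul_eq_zero.1 this with h | h
      · left; linarith
      · right; linarith [pow_eq_zero_iff two_ne_zero |>.1 h]
    · have := mul_nonneg hc (sub_nonneg.2 hab)
      nlinarith [pow_nonneg (sub_nonneg.2 hab) 3]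
    · have := mul_nonneg hc (sub_nonneg.2 hab)
      nlinarith [pow_nonneg (sub_nonneg.2 hab) 3, mul_nonneg (sub_nonneg.2 hab) (sq_nonneg (a + b))]

theorem setLIntegral_eq_lintegral_fiber {M : Set (Y × ℝ)} (hM : MeasurableSet M)
    {g : Y × ℝ → ℝ≥0∞} (hg : Measurable g) :
    ∫⁻ p in M, g p = ∫⁻ y, ∫⁻ r in Prod.mk y ⁻¹' M, g (y, r) := by
  rw [← lintegral_indicator hM, Measure.volume_eq_prod,
    lintegral_prod _ (hg.indicator hM).aemeasurable]
  refine lintegral_congr fun y => ?_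
  rw [← lintegral_indicator (hM.preimage (by fun_prop))]
  rfl

theorem lintegral_steinerProd_le {M : Set (Y × ℝ)} (hM : IsCompact M) (hMx : Convex ℝ M)
    {q : Y → ℝ} (hq : Continuous q) (hq0 : ∀ y, 0 ≤ q y) :
    ∫⁻ p in steinerProd M, ENNReal.ofReal (q p.1 + p.2 ^ 2) ≤
      ∫⁻ p in M, ENNReal.ofReal (q p.1 + p.2 ^ 2) := by
  rw [setLIntegral_eq_lintegral_fiber hM.measurableSet (by fun_prop),
    setLIntegral_eq_lintegral_fiber (isCompact_steinerProd hM).measurableSet (by fun_prop)]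
  refine lintegral_mono fun y => ?_
  obtain ⟨a, b, h1, h2⟩ := exists_fiber_eq_Icc hM hMx y
  rw [h1, h2]
  exact lintegral_Icc_centered_le (hq0 y)

/-- If Steiner symmetrization does not decrease the second moment, then the body is symmetric
almost everywhere. -/
theorem volume_reflection_diff_eq_zero {M : Set (Y × ℝ)} (hM : IsCompact M) (hMx : Convex ℝ M)
    {q : Y → ℝ} (hq : Continuous q) (hq0 : ∀ y, 0 ≤ q y)
    (h : ∫⁻ p in M, ENNReal.ofReal (q p.1 + p.2 ^ 2) ≤
      ∫⁻ p in steinerProd M, ENNReal.ofReal (q p.1 + p.2 ^ 2)) :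
    volume {p | p ∈ M ∧ (p.1, -p.2) ∉ M} = 0 := by
  have hfin : ∫⁻ p in M, ENNReal.ofReal (q p.1 + p.2 ^ 2) < ∞ :=
    ((by fun_prop : Continuous fun p : Y × ℝ => q p.1 + p.2 ^ 2).continuousOn.integrableOn_compact
      hM).lintegral_lt_top
  have hfin' := (lintegral_steinerProd_le hM hMx hq hq0).trans_lt hfin
  have hgm : Measurable fun p : Y × ℝ => ENNReal.ofReal (q p.1 + p.2 ^ 2) := by fun_prop
  have hmeas : MeasurableSet {p | p ∈ M ∧ (p.1, -p.2) ∉ M} :=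
    hM.measurableSet.inter (hM.measurableSet.compl.preimage (by fun_prop))
  rw [setLIntegral_eq_lintegral_fiber hM.measurableSet hgm,
    setLIntegral_eq_lintegral_fiber (isCompact_steinerProd hM).measurableSet hgm] at h
  rw [setLIntegral_eq_lintegral_fiber (isCompact_steinerProd hM).measurableSet hgm] at hfin'
  have hle : ∀ y, ∫⁻ r in Prod.mk y ⁻¹' steinerProd M, ENNReal.ofReal (q y + r ^ 2) ≤
      ∫⁻ r in Prod.mk y ⁻¹' M, ENNReal.ofReal (q y + r ^ 2) := by
    intro y
    obtain ⟨a, b, h1, h2⟩ := exists_fiber_eq_Icc hM hMx y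
    rw [h1, h2]
    exact lintegral_Icc_centered_le (hq0 y)
  have hae := ae_eq_of_ae_le_of_lintegral_le (ae_of_all _ hle) hfin'.ne (by
    have : Measurable fun y => ∫⁻ r, M.indicator
        (fun p : Y × ℝ => ENNReal.ofReal (q p.1 + p.2 ^ 2)) (y, r) :=
      (hgm.indicator hM.measurableSet).lintegral_prod_right'
    refine this.aemeasurable.congr (ae_of_all _ fun y => ?_)
    dsimp only
    rw [← lintegral_indicator (hM.measurableSet.preimage (by fun_prop))]
    rfl) h
  rw [Measure.volume_eq_prod, Measure.measure_prod_null hmeas]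
  filter_upwards [hae] with y hy
  obtain ⟨a, b, h1, h2⟩ := exists_fiber_eq_Icc hM hMx y
  rw [h1, h2] at hy
  have e1 : ∀ r : ℝ, (y, r) ∈ M ↔ a ≤ r ∧ r ≤ b := fun r => by
    rw [← mem_Icc, ← h1]; rfl
  rcases eq_or_eq_neg_of_lintegral_Icc_centered_eq (hq0 y) hy with hba | rfl
  · refine measure_mono_null (t := {a}) ?_ (by simp)
    rintro r ⟨hr, -⟩
    have := (e1 r).1 hr
    simp only [mem_singleton_iff]
    linarith
  · refine measure_mono_null (t := ∅) ?_ measure_empty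
    rintro r ⟨hr, hr'⟩
    have := (e1 r).1 hr
    exact hr' ((e1 _).2 ⟨by linarith, by linarith⟩)

end steiner

section directional

variable {n m N : ℕ}

local notation "ℰ" => EuclideanSpace ℝ (Fin n)
local notation "Y" => Fin m → ℝ

/-- Splitting off a unit direction by a volume-preserving linear isomorphism. -/
theorem exists_split_direction (hn : 0 < n) (u : ℰ) (hu : ‖u‖ = 1) :
    ∃ (m : ℕ) (e : ℰ ≃L[ℝ] (Fin m → ℝ) × ℝ) (q : (Fin m → ℝ) → ℝ), MeasurePreserving e ∧
      e u = (0, 1) ∧ Continuous q ∧ (∀ y, 0 ≤ q y) ∧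
      ∀ x, ‖x‖ ^ 2 = q (e x).1 + (e x).2 ^ 2 := by
  obtain ⟨m, rfl⟩ : ∃ m, n = m + 1 := ⟨n - 1, by omega⟩
  obtain ⟨b, hb⟩ := Orthonormal.exists_orthonormalBasis_extension_of_card_eq (𝕜 := ℝ)
    (E := EuclideanSpace ℝ (Fin (m + 1))) (ι := Fin (m + 1)) (by simp)
    (v := fun _ => u) (s := {0}) (by
      rw [orthonormal_iff_ite]
      rintro ⟨i, hi⟩ ⟨j, hj⟩
      obtain rfl : i = 0 := hi
      obtain rfl : j = 0 := hj
      simp [hu])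
  have hb0 : b 0 = u := hb 0 rfl
  let l : EuclideanSpace ℝ (Fin (m + 1)) ≃ₗ[ℝ] (Fin m → ℝ) × ℝ :=
    { toFun := fun x => (fun j => b.repr x j.succ, b.repr x 0)
      invFun := fun p => b.repr.symm (WithLp.toLp 2 (Fin.cons p.2 p.1))
      map_add' := fun x y => by ext <;> simp
      map_smul' := fun c x => by ext <;> simp
      left_inv := fun x => by
        rw [LinearIsometryEquiv.symm_apply_eq]
        ext i
        refine Fin.cases ?_ (fun j => ?_) i <;> simp
      right_inv := fun p => by ext <;> simp }
  refine ⟨m, l.toContinuousLinearEquiv, fun y => ∑ i, y i ^ 2, ?_, ?_, by fun_prop,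
    fun y => Finset.sum_nonneg fun i _ => sq_nonneg _, fun x => ?_⟩
  · have h1 := ((volume_preserving_piFinSuccAbove (fun _ : Fin (m + 1) => ℝ) 0).comp
      (PiLp.volume_preserving_ofLp (Fin (m + 1)))).comp b.measurePreserving_repr
    have h2 := (Measure.measurePreserving_swap (μ := (volume : Measure ℝ))
      (ν := (volume : Measure (Fin m → ℝ)))).comp h1
    exact h2
  · change ((fun j => b.repr u j.succ, b.repr u 0) : (Fin m → ℝ) × ℝ) = _
    rw [← hb0, b.repr_self]
    ext <;> simp
  · change _ = ∑ i : Fin m, (b.repr x i.succ) ^ 2 + (b.repr x 0) ^ 2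
    rw [← b.repr.norm_map, EuclideanSpace.norm_sq_eq, Fin.sum_univ_succ]
    simp [add_comm]

/-- The volume of the set of `N`-tuples in `L` whose symmetric convex hull has volume
at most `s`. -/
noncomputable def smallHullVolume (N : ℕ) {V : Type*} [AddCommGroup V] [Module ℝ V]
    [MeasureSpace V] (L : Set V) (s : ℝ≥0∞) : ℝ≥0∞ :=
  volume {x : Fin N → V | (∀ i, x i ∈ L) ∧ volume (absHull x) ≤ s}

theorem smallHullVolume_preimage {e : ℰ ≃L[ℝ] Y × ℝ} (he : MeasurePreserving e)
    {M : Set (Y × ℝ)} (hM : IsCompact M) (s : ℝ≥0∞) :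
    smallHullVolume N (e ⁻¹' M) s = smallHullVolume N M s := by
  have hp := volume_preserving_pi (fun _ : Fin N => he)
  rw [smallHullVolume, smallHullVolume,
    ← hp.measure_preimage (measurableSet_volume_absHull_le hM s).nullMeasurableSet]
  congr 1
  ext x
  have h : volume (absHull fun i => e (x i)) = volume (absHull x) := by
    rw [← he.measure_preimage (isCompact_absHull _).measurableSet.nullMeasurableSet]
    have this : e '' absHull x = absHull fun i => e (x i) :=
      image_absHull (e : ℰ →ₗ[ℝ] Y × ℝ) x
    rw [← this, preimage_image_eq _ e.injective]
  simp only [mem_ofPred_eq, mem_preimage, h]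

/-- The second moment of a set. -/
noncomputable def secondMoment (L : Set ℰ) : ℝ≥0∞ := ∫⁻ x in L, ENNReal.ofReal (‖x‖ ^ 2)

theorem secondMoment_preimage {e : ℰ ≃L[ℝ] Y × ℝ} (he : MeasurePreserving e) {q : Y → ℝ}
    (hq : ∀ x, ‖x‖ ^ 2 = q (e x).1 + (e x).2 ^ 2) (M : Set (Y × ℝ)) :
    secondMoment (e ⁻¹' M) = ∫⁻ p in M, ENNReal.ofReal (q p.1 + p.2 ^ 2) := by
  rw [← he.setLIntegral_comp_preimage_emb e.toHomeomorph.measurableEmbedding, secondMoment]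
  simp only [hq]

/-- A nonempty symmetric compact convex set inside a ball, of given volume, with a lower bound
on its small hull volumes. -/
structure IsCandidate (N : ℕ) (R : ℝ) (K L : Set ℰ) : Prop where
  isCompact : IsCompact L
  convex : Convex ℝ L
  neg_mem : ∀ x ∈ L, -x ∈ L
  nonempty : L.Nonempty
  subset : L ⊆ Metric.closedBall 0 R
  volume_eq : volume L = volume K
  le : ∀ s, smallHullVolume N K s ≤ smallHullVolume N L s

theorem IsCandidate.preimage_steinerProd {R : ℝ} {K L : Set ℰ} (hL : IsCandidate N R K L)
    {e : ℰ ≃L[ℝ] Y × ℝ} (he : MeasurePreserving e) {q : Y → ℝ}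
    (hq : ∀ x, ‖x‖ ^ 2 = q (e x).1 + (e x).2 ^ 2) :
    IsCandidate N R K (e ⁻¹' steinerProd (e '' L)) := by
  have hMc : IsCompact (e '' L) := hL.isCompact.image e.continuous
  have hMx : Convex ℝ (e '' L) := hL.convex.linear_image (e : ℰ →ₗ[ℝ] Y × ℝ)
  have hpre : e ⁻¹' (e '' L) = L := preimage_image_eq _ e.injective
  refine ⟨?_, ?_, ?_, ?_, ?_, ?_, fun s => ?_⟩
  · exact e.toHomeomorph.isCompact_preimage.2 (isCompact_steinerProd hMc)
  · exact (convex_steinerProd hMx).linear_preimage (e : ℰ →ₗ[ℝ] Y × ℝ)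
  · intro x hx
    have := neg_mem_steinerProd (M := e '' L) (by
      rintro _ ⟨z, hz, rfl⟩
      exact ⟨-z, hL.neg_mem z hz, by simp⟩) _ hx
    simpa using this
  · obtain ⟨x, hx⟩ := hL.nonempty
    refine ⟨e.symm ((e x).1, 0), (e x).2, (e x).2, ?_, ?_, ?_⟩ <;> simp [hx]
  · rintro x ⟨a, b, ⟨z, hz, hz'⟩, ⟨z', hz2, hz2'⟩, hx⟩
    have hz3 := hL.subset hz
    have hz4 := hL.subset hz2
    simp only [Metric.mem_closedBall, dist_zero_right] at hz3 hz4 ⊢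
    have hR : 0 ≤ R := (norm_nonneg _).trans hz3
    have h1 := hq z
    have h2 := hq z'
    have h3 := hq x
    rw [hz'] at h1
    rw [hz2'] at h2
    rw [hx] at h3
    simp only at h1 h2
    refine (pow_le_pow_iff_left₀ (norm_nonneg _) hR two_ne_zero).1 ?_
    have h5 : ‖z‖ ^ 2 ≤ R ^ 2 := by gcongr
    have h6 : ‖z'‖ ^ 2 ≤ R ^ 2 := by gcongr
    nlinarith [sq_nonneg (a + b)]
  · rw [he.measure_preimage (isCompact_steinerProd hMc).measurableSet.nullMeasurableSet,
      volume_steinerProd hMc hMx, ← hL.volume_eq,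
      ← he.measure_preimage hMc.measurableSet.nullMeasurableSet, hpre]
  · refine (hL.le s).trans ?_
    rw [smallHullVolume_preimage he (isCompact_steinerProd hMc)]
    conv_lhs => rw [← hpre, smallHullVolume_preimage he hMc]
    exact volume_absHull_le_steinerProd hMc hMx s

/-- A candidate of least second moment is symmetric about every hyperplane through the origin. -/
theorem IsCandidate.mem_of_forall_secondMoment_le {R : ℝ} {K L : Set ℰ}
    (hL : IsCandidate N R K L) (hL0 : volume L ≠ 0)
    (hmin : ∀ L', IsCandidate N R K L' → secondMoment L ≤ secondMoment L')
    {e : ℰ ≃L[ℝ] Y × ℝ} (he : MeasurePreserving e) {q : Y → ℝ} (hqc : Continuous q)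
    (hq0 : ∀ y, 0 ≤ q y) (hq : ∀ x, ‖x‖ ^ 2 = q (e x).1 + (e x).2 ^ 2) {x : ℰ} (hx : x ∈ L) :
    e.symm ((e x).1, -(e x).2) ∈ L := by
  have hMc : IsCompact (e '' L) := hL.isCompact.image e.continuous
  have hMx : Convex ℝ (e '' L) := hL.convex.linear_image (e : ℰ →ₗ[ℝ] Y × ℝ)
  have hpre : e ⁻¹' (e '' L) = L := preimage_image_eq _ e.injective
  have h := hmin _ (hL.preimage_steinerProd he hq)
  rw [secondMoment_preimage he hq] at h
  conv_lhs at h => rw [← hpre, secondMoment_preimage he hq]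
  have h0 := volume_reflection_diff_eq_zero hMc hMx hqc hq0 h
  have hmem : ∀ z : Y × ℝ, z ∈ e '' L ↔ e.symm z ∈ L := by
    intro z
    constructor
    · rintro ⟨w, hw, rfl⟩; simpa using hw
    · intro hz; exact ⟨_, hz, by simp⟩
  have h1 : volume {x | x ∈ L ∧ e.symm ((e x).1, -(e x).2) ∉ L} = 0 := by
    have hmeas : MeasurableSet {p : Y × ℝ | p ∈ e '' L ∧ (p.1, -p.2) ∉ e '' L} :=
      hMc.measurableSet.inter (hMc.measurableSet.compl.preimage (by fun_prop))
    rw [← he.measure_preimage hmeas.nullMeasurableSet] at h0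
    convert h0 using 2
    ext z
    simp [hmem]
  have hint : (interior L).Nonempty := by
    by_contra hne
    rw [not_nonempty_iff_eq_empty] at hne
    apply hL0
    have := hL.convex.addHaar_frontier volume
    rwa [frontier, hne, sdiff_empty, hL.isCompact.isClosed.closure_eq] at this
  set T : Set ℰ := {x | e.symm ((e x).1, -(e x).2) ∈ L} with hT
  have hTc : IsClosed T := hL.isCompact.isClosed.preimage (by fun_prop)
  have hsub : interior L ⊆ T := by
    have ho : IsOpen (interior L \ T) := isOpen_interior.sdiff hTc
    have h2 : volume (interior L \ T) = 0 :=
      measure_mono_null (t := {x | x ∈ L ∧ e.symm ((e x).1, -(e x).2) ∉ L})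
        (fun z hz => ⟨interior_subset hz.1, hz.2⟩) h1
    rw [ho.measure_eq_zero_iff volume] at h2
    exact sdiff_eq_bot_iff.1 h2
  have := hL.convex.closure_interior_eq_closure_of_nonempty_interior hint
  rw [hL.isCompact.isClosed.closure_eq] at this
  exact (hTc.closure_subset_iff.2 hsub) (by rw [this]; exact hx)

/-- A candidate of least second moment is a centered ball. -/
theorem IsCandidate.eq_closedBall (hn : 0 < n) {R : ℝ} {K L : Set ℰ}
    (hL : IsCandidate N R K L) (hL0 : volume L ≠ 0)
    (hmin : ∀ L', IsCandidate N R K L' → secondMoment L ≤ secondMoment L') :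
    ∃ r, 0 < r ∧ L = Metric.closedBall 0 r := by
  obtain ⟨x, hx, hxm⟩ := hL.isCompact.exists_isMaxOn hL.nonempty (f := fun x => ‖x‖) (by fun_prop)
  have hne : Nonempty (Fin n) := ⟨⟨0, hn⟩⟩
  have hsub : L ⊆ Metric.closedBall 0 ‖x‖ := fun z hz => by simpa using hxm hz
  have hr : 0 < ‖x‖ := by
    rw [norm_pos_iff]
    rintro rfl
    apply hL0
    refine measure_mono_null hsub ?_
    simp
  refine ⟨‖x‖, hr, hsub.antisymm ?_⟩
  rw [← convexHull_sphere_eq_closedBall 0 hr.le]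
  refine convexHull_min (fun z hz => ?_) hL.convex
  have hz' : ‖z‖ = ‖x‖ := by simpa using hz
  by_cases hxz : x = z
  · exact hxz ▸ hx
  have hd : 0 < ‖x - z‖ := norm_pos_iff.2 (sub_ne_zero.2 hxz)
  obtain ⟨m, e, q, he, heu, hqc, hq0, hq⟩ := exists_split_direction hn (‖x - z‖⁻¹ • (x - z))
    (by rw [norm_smul, norm_inv, norm_norm, inv_mul_cancel₀ hd.ne'])
  have key := hL.mem_of_forall_secondMoment_le hL0 hmin he hqc hq0 hq hx
  have h1 : e x - e z = (0, ‖x - z‖) := by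
    have h : x - z = ‖x - z‖ • ‖x - z‖⁻¹ • (x - z) := (smul_inv_smul₀ hd.ne' _).symm
    rw [← map_sub]
    conv_lhs => rw [h, map_smul, heu]
    simp
  have h2 : (e x).1 = (e z).1 := by
    have := congrArg Prod.fst h1
    simpa [sub_eq_zero] using this
  have h3 : (e x).2 - (e z).2 = ‖x - z‖ := congrArg Prod.snd h1
  have h4 : (e x).2 ^ 2 = (e z).2 ^ 2 := by
    have := hq x
    have h5 := hq z
    rw [hz'] at h5
    rw [h2] at this
    linarith
  have h5 : -(e x).2 = (e z).2 := by
    have : ((e x).2 - (e z).2) * ((e x).2 + (e z).2) = 0 := by linarith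
    rw [h3] at this
    linarith [(mul_eq_zero.1 this).resolve_left hd.ne']
  rw [h5, h2] at key
  simpa using key

end directional

section compactness

variable {n N : ℕ}

local notation "ℰ" => EuclideanSpace ℝ (Fin n)

open TopologicalSpace

/-- Hausdorff convergence of compact convex sets implies pointwise convergence of membership
off the frontier of the limit. -/
theorem eventually_mem_iff_of_tendsto {C : ℕ → NonemptyCompacts ℰ} {D : NonemptyCompacts ℰ}
    (hC : ∀ k, Convex ℝ (C k : Set ℰ)) (h : Tendsto C atTop (𝓝 D)) {x : ℰ}
    (hx : x ∉ frontier (D : Set ℰ)) : ∀ᶠ k in atTop, x ∈ (C k : Set ℰ) ↔ x ∈ (D : Set ℰ) := by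
  by_cases hxD : x ∈ (D : Set ℰ)
  · have hxi : x ∈ interior (D : Set ℰ) := by
      by_contra hxi
      exact hx ⟨subset_closure hxD, hxi⟩
    obtain ⟨ε, hε, hball⟩ :=
      Metric.nhds_basis_closedBall.mem_iff.1 (mem_interior_iff_mem_nhds.1 hxi)
    filter_upwards [h.eventually (Metric.ball_mem_nhds D hε)] with k hk
    refine iff_of_true ?_ hxD
    by_contra hxk
    obtain ⟨f, u, hf, hu⟩ := geometric_hahn_banach_closed_point (hC k) (C k).isCompact.isClosed hxk
    set v := (InnerProductSpace.toDual ℝ ℰ).symm f with hv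
    have hfv : ∀ y, f y = inner ℝ v y := fun y => (InnerProductSpace.toDual_symm_apply).symm
    have hv0 : v ≠ 0 := by
      intro h0
      obtain ⟨a, ha⟩ := (C k).nonempty
      have h1 := (hf a ha).trans hu
      rw [hfv, hfv, h0, inner_zero_left, inner_zero_left] at h1
      exact h1.false
    have hvn : 0 < ‖v‖ := norm_pos_iff.2 hv0
    have hz : x + (ε * ‖v‖⁻¹) • v ∈ (D : Set ℰ) := by
      apply hball
      rw [Metric.mem_closedBall, dist_eq_norm, add_sub_cancel_left, norm_smul, norm_mul, norm_inv,
        norm_norm, Real.norm_of_nonneg hε.le]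
      field_simp
      exact le_rfl
    have hk' : Metric.hausdorffDist (D : Set ℰ) (C k : Set ℰ) < ε := by
      rwa [← Metric.NonemptyCompacts.dist_eq, dist_comm]
    obtain ⟨a, ha, hda⟩ := Metric.exists_dist_lt_of_hausdorffDist_lt hz hk'
      (Metric.hausdorffEDist_ne_top_of_nonempty_of_bounded D.nonempty (C k).nonempty
        D.isCompact.isBounded (C k).isCompact.isBounded)
    have h1 := real_inner_le_norm v (x + (ε * ‖v‖⁻¹) • v - a)
    rw [← dist_eq_norm] at h1
    have h2 : inner ℝ v (x + (ε * ‖v‖⁻¹) • v - a) = f x - f a + ε * ‖v‖ := by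
      rw [inner_sub_right, inner_add_right, inner_smul_right, real_inner_self_eq_norm_sq, hfv, hfv]
      field_simp
      ring
    have h3 := hf a ha
    nlinarith
  · have h0 : 0 < Metric.infDist x (D : Set ℰ) :=
      (D.isCompact.isClosed.notMem_iff_infDist_pos D.nonempty).1 hxD
    have h1 : Tendsto (fun k => Metric.infDist x (C k : Set ℰ)) atTop
        (𝓝 (Metric.infDist x (D : Set ℰ))) :=
      ((Metric.lipschitz_infDist_set x).continuous.tendsto D).comp h
    filter_upwards [h1.eventually (lt_mem_nhds h0)] with k hk
    exact iff_of_false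
      (((C k).isCompact.isClosed.notMem_iff_infDist_pos (C k).nonempty).2 hk) hxD

theorem tendsto_measure_of_tendsto_nonemptyCompacts {ν : Measure ℰ} (hν : ν ≪ volume)
    {C : ℕ → NonemptyCompacts ℰ} {D : NonemptyCompacts ℰ}
    (hC : ∀ k, Convex ℝ (C k : Set ℰ)) (hD : Convex ℝ (D : Set ℰ)) (h : Tendsto C atTop (𝓝 D))
    {R : ℝ} (hR : ∀ k, (C k : Set ℰ) ⊆ Metric.closedBall 0 R)
    (hνR : ν (Metric.closedBall 0 R) ≠ ∞) :
    Tendsto (fun k => ν (C k : Set ℰ)) atTop (𝓝 (ν (D : Set ℰ))) := by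
  refine tendsto_measure_of_ae_tendsto_indicator atTop D.isCompact.measurableSet
    (fun k => (C k).isCompact.measurableSet) measurableSet_closedBall hνR (.of_forall hR) ?_
  have h0 : ∀ᵐ x ∂ν, x ∉ frontier (D : Set ℰ) :=
    measure_eq_zero_iff_ae_notMem.1 (hν (hD.addHaar_frontier volume))
  filter_upwards [h0] with x hx using eventually_mem_iff_of_tendsto hC h hx

theorem tendsto_smallHullVolume {C : ℕ → NonemptyCompacts ℰ} {D : NonemptyCompacts ℰ}
    (hC : ∀ k, Convex ℝ (C k : Set ℰ)) (hD : Convex ℝ (D : Set ℰ)) (h : Tendsto C atTop (𝓝 D))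
    {R : ℝ} (hR : ∀ k, (C k : Set ℰ) ⊆ Metric.closedBall 0 R) (s : ℝ≥0∞) :
    Tendsto (fun k => smallHullVolume N (C k : Set ℰ) s) atTop
      (𝓝 (smallHullVolume N (D : Set ℰ) s)) := by
  refine tendsto_measure_of_ae_tendsto_indicator atTop
    (measurableSet_volume_absHull_le D.isCompact s)
    (fun k => measurableSet_volume_absHull_le (C k).isCompact s)
    (B := univ.pi fun _ => Metric.closedBall 0 R)
    (MeasurableSet.univ_pi fun _ => measurableSet_closedBall) ?_
    (.of_forall fun k x hx i _ => hR k (hx.1 i)) ?_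
  · rw [volume_pi_pi]
    exact ENNReal.prod_ne_top fun _ _ => measure_closedBall_lt_top.ne
  · have h0 : ∀ᵐ x : Fin N → ℰ, ∀ i, x i ∉ frontier (D : Set ℰ) := by
      refine ae_all_iff.2 fun i => ?_
      exact (Measure.quasiMeasurePreserving_eval (fun _ : Fin N => (volume : Measure ℰ)) i).ae
        (measure_eq_zero_iff_ae_notMem.1 (hD.addHaar_frontier volume))
    filter_upwards [h0] with x hx
    filter_upwards [eventually_all.2 fun i => eventually_mem_iff_of_tendsto hC h (hx i)] with k hk
    exact and_congr_left fun _ => forall_congr' hk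

/-- Among all candidates there is one of least second moment. -/
theorem IsCandidate.exists_forall_secondMoment_le {R : ℝ} {K L₀ : Set ℰ}
    (h₀ : IsCandidate N R K L₀) : ∃ L, IsCandidate N R K L ∧
      ∀ L', IsCandidate N R K L' → secondMoment L ≤ secondMoment L' := by
  obtain ⟨u, -, hu, huS⟩ := exists_seq_tendsto_sInf (S := secondMoment '' {L | IsCandidate N R K L})
    ⟨_, L₀, h₀, rfl⟩ (OrderBot.bddBelow _)
  choose Ls hLs hLu using huS
  let C : ℕ → NonemptyCompacts ℰ := fun k => ⟨⟨Ls k, (hLs k).isCompact⟩, (hLs k).nonempty⟩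
  obtain ⟨D, hDR, φ, hφ, hlim⟩ := (NonemptyCompacts.isCompact_subsets_of_isCompact
    (isCompact_closedBall (0 : ℰ) R)).tendsto_subseq (x := C) (fun k => (hLs k).subset)
  have hCc : ∀ k, Convex ℝ ((C ∘ φ) k : Set ℰ) := fun k => (hLs _).convex
  have hCR : ∀ k, ((C ∘ φ) k : Set ℰ) ⊆ Metric.closedBall 0 R := fun k => (hLs _).subset
  have hinf : ∀ x, Tendsto (fun k => Metric.infDist x ((C ∘ φ) k : Set ℰ)) atTop
      (𝓝 (Metric.infDist x (D : Set ℰ))) := fun x =>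
    ((Metric.lipschitz_infDist_set x).continuous.tendsto D).comp hlim
  have hmem : ∀ x : ℰ, x ∈ (D : Set ℰ) ↔ Metric.infDist x (D : Set ℰ) ≤ 0 := fun x => by
    rw [D.isCompact.isClosed.mem_iff_infDist_zero D.nonempty]
    exact ⟨fun h => h.le, fun h => h.antisymm Metric.infDist_nonneg⟩
  have hDc : Convex ℝ (D : Set ℰ) := by
    intro x hx y hy a b ha hb hab
    rw [hmem] at hx hy ⊢
    have hlim2 := ((hinf x).const_mul a).add ((hinf y).const_mul b)
    refine (le_of_tendsto_of_tendsto' (hinf _) hlim2 fun k => ?_).trans (by nlinarith)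
    obtain ⟨x', hx', hxd⟩ := ((C ∘ φ) k).isCompact.exists_infDist_eq_dist ((C ∘ φ) k).nonempty x
    obtain ⟨y', hy', hyd⟩ := ((C ∘ φ) k).isCompact.exists_infDist_eq_dist ((C ∘ φ) k).nonempty y
    rw [hxd, hyd]
    refine (Metric.infDist_le_dist_of_mem (hCc k hx' hy' ha hb hab)).trans ?_
    rw [dist_eq_norm, dist_eq_norm, dist_eq_norm]
    calc ‖a • x + b • y - (a • x' + b • y')‖ = ‖a • (x - x') + b • (y - y')‖ := by
          congr 1; module
      _ ≤ ‖a • (x - x')‖ + ‖b • (y - y')‖ := norm_add_le _ _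
      _ = a * ‖x - x'‖ + b * ‖y - y'‖ := by
          rw [norm_smul, norm_smul, Real.norm_of_nonneg ha, Real.norm_of_nonneg hb]
  have hDn : ∀ x ∈ (D : Set ℰ), -x ∈ (D : Set ℰ) := by
    intro x hx
    rw [hmem] at hx ⊢
    refine (le_of_tendsto_of_tendsto' (hinf _) (hinf x) fun k => ?_).trans hx
    obtain ⟨x', hx', hxd⟩ := ((C ∘ φ) k).isCompact.exists_infDist_eq_dist ((C ∘ φ) k).nonempty x
    rw [hxd, ← dist_neg_neg]
    exact Metric.infDist_le_dist_of_mem ((hLs _).neg_mem _ hx')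
  have hvol := tendsto_measure_of_tendsto_nonemptyCompacts Measure.AbsolutelyContinuous.rfl
    hCc hDc hlim hCR measure_closedBall_lt_top.ne
  have hmom : Tendsto (fun k => secondMoment ((C ∘ φ) k : Set ℰ)) atTop
      (𝓝 (secondMoment (D : Set ℰ))) := by
    have := tendsto_measure_of_tendsto_nonemptyCompacts
      (withDensity_absolutelyContinuous volume fun x : ℰ => ENNReal.ofReal (‖x‖ ^ 2))
      hCc hDc hlim hCR (by
        rw [withDensity_apply _ measurableSet_closedBall]
        exact (setLIntegral_lt_top_of_isCompact measure_closedBall_lt_top.ne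
          (isCompact_closedBall _ _) (f := fun x : ℰ => Real.toNNReal (‖x‖ ^ 2))
          (by fun_prop)).ne)
    simpa only [withDensity_apply _ (NonemptyCompacts.isCompact _).measurableSet,
      secondMoment] using this
  refine ⟨D, ⟨D.isCompact, hDc, hDn, D.nonempty, hDR, ?_, fun s => ?_⟩, fun L' hL' => ?_⟩
  · refine tendsto_nhds_unique hvol ?_
    exact tendsto_const_nhds.congr fun k => ((hLs (φ k)).volume_eq).symm
  · exact ge_of_tendsto' (tendsto_smallHullVolume hCc hDc hlim hCR s) fun k => (hLs (φ k)).le s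
  · have h1 : secondMoment (D : Set ℰ) = sInf (secondMoment '' {L | IsCandidate N R K L}) := by
      refine tendsto_nhds_unique hmom ?_
      exact (hu.comp hφ.tendsto_atTop).congr fun k => (hLu (φ k)).symm
    rw [h1]
    exact sInf_le ⟨L', hL', rfl⟩

/-- Some centered ball of the same volume as a symmetric convex body dominates it in terms of
small hull volumes. -/
theorem exists_closedBall_smallHullVolume_le (hn : 0 < n) (N : ℕ) {K : Set ℰ}
    (hKc : Convex ℝ K) (hK : IsCompact K) (hKs : ∀ x ∈ K, -x ∈ K) (hK0 : volume K ≠ 0) :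
    ∃ r, 0 < r ∧ volume (Metric.closedBall (0 : ℰ) r) = volume K ∧
      ∀ s, smallHullVolume N K s ≤ smallHullVolume N (Metric.closedBall (0 : ℰ) r) s := by
  obtain ⟨R, hR⟩ := hK.isBounded.subset_closedBall 0
  have h₀ : IsCandidate N R K K :=
    ⟨hK, hKc, hKs, nonempty_of_measure_ne_zero hK0, hR, rfl, fun _ => le_rfl⟩
  obtain ⟨L, hL, hmin⟩ := h₀.exists_forall_secondMoment_le
  obtain ⟨r, hr, rfl⟩ := hL.eq_closedBall hn (hL.volume_eq ▸ hK0) hmin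
  exact ⟨r, hr, hL.volume_eq, hL.le⟩

end compactness

section random

variable {n N : ℕ}

local notation "ℰ" => EuclideanSpace ℝ (Fin n)

theorem pi_smul_restrict {ι V : Type*} [Fintype ι] [MeasurableSpace V] (μ : Measure V)
    [SigmaFinite μ] {c : ℝ≥0∞} (hc : c ≠ ∞) {K : Set V} (hK : μ K ≠ ∞) :
    Measure.pi (fun _ : ι => c • μ.restrict K) =
      c ^ Fintype.card ι • (Measure.pi fun _ : ι => μ).restrict (univ.pi fun _ => K) := by
  have : IsFiniteMeasure (μ.restrict K) := isFiniteMeasure_restrict.2 hK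
  have : IsFiniteMeasure (c • μ.restrict K) := Measure.smul_finite _ hc
  refine Measure.pi_eq fun s hs => ?_
  rw [Measure.restrict_pi_pi]
  simp [Finset.prod_mul_distrib]

theorem jointUnif_apply_of_isCompact {K : Set ℰ} (hK : IsCompact K) (hK0 : volume K ≠ 0)
    {A : Set (Fin N → ℰ)} :
    jointUnif n N K A = ((volume K)⁻¹) ^ N * volume {x | (∀ i, x i ∈ K) ∧ x ∈ A} := by
  rw [jointUnif]
  simp only [unifMeasure]
  rw [pi_smul_restrict _ (ENNReal.inv_ne_top.2 hK0) hK.measure_ne_top, Measure.smul_apply,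
    Measure.restrict_apply' (MeasurableSet.univ_pi fun _ => hK.measurableSet), Fintype.card_fin]
  rw [smul_eq_mul, ← volume_pi, inter_comm]
  congr 2
  ext x
  simp [mem_inter_iff]

theorem isProbabilityMeasure_unifMeasure {K : Set ℰ} (hK : IsCompact K) (hK0 : volume K ≠ 0) :
    IsProbabilityMeasure (unifMeasure n K) :=
  ⟨by simp [unifMeasure, ENNReal.inv_mul_cancel hK0 hK.measure_ne_top]⟩

theorem isProbabilityMeasure_jointUnif {K : Set ℰ} (hK : IsCompact K) (hK0 : volume K ≠ 0) :
    IsProbabilityMeasure (jointUnif n N K) := by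
  have := isProbabilityMeasure_unifMeasure hK hK0
  unfold jointUnif
  infer_instance

theorem randSymPolyVol_eq (hN : 0 < N) (K : Set ℰ) (x : Fin N → ℰ) :
    randSymPolyVol n N K x = (volume (absHull x)).toReal / (volume K).toReal := by
  rw [randSymPolyVol, convexHull_range_union_neg hN]

theorem randSymPolyVol_nonneg (K : Set ℰ) (x : Fin N → ℰ) : 0 ≤ randSymPolyVol n N K x :=
  div_nonneg ENNReal.toReal_nonneg ENNReal.toReal_nonneg

theorem measurable_randSymPolyVol (hN : 0 < N) (K : Set ℰ) :
    Measurable (randSymPolyVol n N K) := by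
  simp_rw [funext (randSymPolyVol_eq hN K)]
  exact (measurable_volume_absHull volume).ennreal_toReal.div_const _

theorem measurable_comp_randSymPolyVol (hN : 0 < N) (K : Set ℰ) {f : ℝ → ℝ}
    (hf : ContinuousOn f (Ici 0)) : Measurable fun x => f (randSymPolyVol n N K x) := by
  have h1 : Continuous fun y : ℝ => f (max y 0) :=
    hf.comp_continuous (by fun_prop) fun y => mem_Ici.2 (le_max_right _ _)
  convert h1.measurable.comp (measurable_randSymPolyVol hN K) using 1
  ext x
  simp [max_eq_left (randSymPolyVol_nonneg K x)]

theorem jointUnif_setOf_randSymPolyVol_le (hN : 0 < N) {K : Set ℰ} (hK : IsCompact K)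
    (hK0 : volume K ≠ 0) {a : ℝ} (ha : 0 ≤ a) :
    jointUnif n N K {x | randSymPolyVol n N K x ≤ a} =
      ((volume K)⁻¹) ^ N * smallHullVolume N K (ENNReal.ofReal a * volume K) := by
  rw [jointUnif_apply_of_isCompact hK hK0, smallHullVolume]
  congr 3
  ext x
  have hKr : 0 < (volume K).toReal := ENNReal.toReal_pos hK0 hK.measure_ne_top
  have h1 := (isCompact_absHull x).measure_ne_top (μ := volume)
  simp only [mem_ofPred_eq, randSymPolyVol_eq hN, div_le_iff₀ hKr]
  rw [← ENNReal.toReal_le_toReal h1 (ENNReal.mul_ne_top ENNReal.ofReal_ne_top hK.measure_ne_top),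
    ENNReal.toReal_mul, ENNReal.toReal_ofReal ha]

/-- A sublevel set of a strictly increasing continuous function on the half-line is an initial
closed interval, everything, or empty. -/
theorem exists_sublevel_eq {f : ℝ → ℝ} (hm : StrictMonoOn f (Ici 0)) (hc : ContinuousOn f (Ici 0))
    (t : ℝ) : (∃ a, 0 ≤ a ∧ ∀ y, 0 ≤ y → (f y ≤ t ↔ y ≤ a)) ∨ (∀ y, 0 ≤ y → f y ≤ t) ∨
      ∀ y, 0 ≤ y → ¬ f y ≤ t := by
  by_cases h : t ∈ f '' Ici 0
  · obtain ⟨a, ha, rfl⟩ := h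
    exact .inl ⟨a, ha, fun y hy => hm.le_iff_le hy ha⟩
  · refine .inr ?_
    by_contra! hcon
    obtain ⟨⟨y, hy, hy1⟩, z, hz, hz1⟩ := hcon
    exact h (isPreconnected_Ici.intermediate_value hz hy hc ⟨hz1, hy1.le⟩)

theorem jointUnif_lt_le_of_smallHullVolume_le (hN : 0 < N) {K B : Set ℰ} (hK : IsCompact K)
    (hB : IsCompact B) (hK0 : volume K ≠ 0) (hBK : volume B = volume K)
    (h : ∀ s, smallHullVolume N K s ≤ smallHullVolume N B s) {f : ℝ → ℝ}
    (hm : StrictMonoOn f (Ici 0)) (hc : ContinuousOn f (Ici 0)) (t : ℝ) :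
    jointUnif n N B {x | t < f (randSymPolyVol n N B x)} ≤
      jointUnif n N K {x | t < f (randSymPolyVol n N K x)} := by
  have hB0 : volume B ≠ 0 := hBK ▸ hK0
  have := isProbabilityMeasure_jointUnif (N := N) hK hK0
  have := isProbabilityMeasure_jointUnif (N := N) hB hB0
  rcases exists_sublevel_eq hm hc t with ⟨a, ha, hfa⟩ | hall | hnone
  · have key : ∀ L : Set ℰ, {x : Fin N → ℰ | t < f (randSymPolyVol n N L x)} =
        {x | randSymPolyVol n N L x ≤ a}ᶜ := fun L => by
      ext x
      simp only [mem_compl_iff, mem_ofPred_eq, ← hfa _ (randSymPolyVol_nonneg L x), not_le]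
    have hmeas : ∀ L : Set ℰ, MeasurableSet {x : Fin N → ℰ | randSymPolyVol n N L x ≤ a} :=
      fun L => measurable_randSymPolyVol hN L measurableSet_Iic
    rw [key, key, prob_compl_eq_one_sub (hmeas B), prob_compl_eq_one_sub (hmeas K)]
    refine tsub_le_tsub_left ?_ _
    rw [jointUnif_setOf_randSymPolyVol_le hN hK hK0 ha,
      jointUnif_setOf_randSymPolyVol_le hN hB hB0 ha, hBK]
    gcongr
    exact h _
  · refine (measure_mono_null (fun x hx => ?_) measure_empty).le.trans zero_le
    exact (hall _ (randSymPolyVol_nonneg B x)).not_gt hx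
  · refine prob_le_one.trans (le_of_eq ?_)
    rw [← measure_univ (μ := jointUnif n N K)]
    congr 1
    ext x
    simpa using hnone _ (randSymPolyVol_nonneg K x)

theorem ae_jointUnif_randSymPolyVol_le_one {K : Set ℰ} (hK : IsCompact K)
    (hK0 : volume K ≠ 0) (hKc : Convex ℝ K) (hKs : ∀ x ∈ K, -x ∈ K) :
    ∀ᵐ x ∂jointUnif n N K, randSymPolyVol n N K x ≤ 1 := by
  rw [ae_iff, jointUnif_apply_of_isCompact hK hK0]
  rw [mul_eq_zero]
  refine .inr (measure_mono_null (fun x hx => hx.2 ?_) measure_empty)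
  refine div_le_one_of_le₀ (ENNReal.toReal_mono hK.measure_ne_top (measure_mono ?_))
    ENNReal.toReal_nonneg
  refine convexHull_min (union_subset ?_ ?_) hKc
  · rintro _ ⟨i, rfl⟩
    exact hx.1 i
  · rintro y ⟨i, hi⟩
    simpa [hi] using hKs _ (hx.1 i)

theorem integral_comp_randSymPolyVol_le_of_smallHullVolume_le (hN : 0 < N) {K B : Set ℰ}
    (hK : IsCompact K) (hKc : Convex ℝ K) (hKs : ∀ x ∈ K, -x ∈ K)
    (hB : IsCompact B) (hK0 : volume K ≠ 0) (hBK : volume B = volume K)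
    (h : ∀ s, smallHullVolume N K s ≤ smallHullVolume N B s) {f : ℝ → ℝ}
    (hm : StrictMonoOn f (Ici 0)) (hc : ContinuousOn f (Ici 0)) (h0 : ∀ t, 0 ≤ t → 0 ≤ f t) :
    ∫ x, f (randSymPolyVol n N B x) ∂jointUnif n N B ≤
      ∫ x, f (randSymPolyVol n N K x) ∂jointUnif n N K := by
  have := isProbabilityMeasure_jointUnif (N := N) hK hK0
  have hnn : ∀ (L : Set ℰ) (x : Fin N → ℰ), 0 ≤ f (randSymPolyVol n N L x) :=
    fun L x => h0 _ (randSymPolyVol_nonneg L x)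
  have hmeas := fun L : Set ℰ => measurable_comp_randSymPolyVol hN L hc
  rw [integral_eq_lintegral_of_nonneg_ae (.of_forall (hnn B)) (hmeas B).aestronglyMeasurable,
    integral_eq_lintegral_of_nonneg_ae (.of_forall (hnn K)) (hmeas K).aestronglyMeasurable]
  refine ENNReal.toReal_mono ?_ ?_
  · refine ne_top_of_le_ne_top (b := ∫⁻ _, ENNReal.ofReal (f 1) ∂jointUnif n N K) (by simp)
      (lintegral_mono_ae ?_)
    filter_upwards [ae_jointUnif_randSymPolyVol_le_one hK hK0 hKc hKs] with x hx
    exact ENNReal.ofReal_le_ofReal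
      (hm.monotoneOn (randSymPolyVol_nonneg K x) (mem_Ici.2 zero_le_one) hx)
  · rw [lintegral_eq_lintegral_meas_lt _ (.of_forall (hnn B)) (hmeas B).aemeasurable,
      lintegral_eq_lintegral_meas_lt _ (.of_forall (hnn K)) (hmeas K).aemeasurable]
    exact lintegral_mono fun t => jointUnif_lt_le_of_smallHullVolume_le hN hK hB hK0 hBK h hm hc t

theorem measurePreserving_smul_unifMeasure {r : ℝ} (hr : r ≠ 0) (K : Set ℰ)
    (hK : MeasurableSet K) :
    MeasurePreserving (fun x : ℰ => r • x) (unifMeasure n K) (unifMeasure n (r • K)) := by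
  refine ⟨by fun_prop, ?_⟩
  ext A hA
  have hpre : r • ((fun x : ℰ => r • x) ⁻¹' A ∩ K) = A ∩ r • K := by
    rw [smul_set_inter₀ hr, preimage_smul₀ hr, smul_inv_smul₀ hr]
  have hc : ENNReal.ofReal |r ^ Module.finrank ℝ ℰ| ≠ 0 := by
    simpa using pow_ne_zero _ hr
  rw [Measure.map_apply (by fun_prop) hA, unifMeasure, unifMeasure, Measure.smul_apply,
    Measure.smul_apply, Measure.restrict_apply' hK, Measure.restrict_apply hA, ← hpre,
    Measure.addHaar_smul, Measure.addHaar_smul, smul_eq_mul, smul_eq_mul,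
    ENNReal.mul_inv (.inl hc) (.inl ENNReal.ofReal_ne_top), mul_mul_mul_comm,
    ENNReal.inv_mul_cancel hc ENNReal.ofReal_ne_top, one_mul]

theorem randSymPolyVol_smul (hN : 0 < N) {r : ℝ} (hr : r ≠ 0) (K : Set ℰ) (x : Fin N → ℰ) :
    randSymPolyVol n N (r • K) (fun i => r • x i) = randSymPolyVol n N K x := by
  have h : r • absHull x = absHull fun i => r • x i :=
    image_absHull (r • LinearMap.id : ℰ →ₗ[ℝ] ℰ) x
  have hc : (ENNReal.ofReal |r ^ Module.finrank ℝ ℰ|).toReal ≠ 0 := by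
    rw [ENNReal.toReal_ofReal (abs_nonneg _)]
    exact abs_ne_zero.2 (pow_ne_zero _ hr)
  rw [randSymPolyVol_eq hN, randSymPolyVol_eq hN, ← h, Measure.addHaar_smul, Measure.addHaar_smul,
    ENNReal.toReal_mul, ENNReal.toReal_mul, mul_div_mul_left _ _ hc]

theorem integral_comp_randSymPolyVol_smul (hN : 0 < N) {r : ℝ} (hr : r ≠ 0) {K : Set ℰ}
    (hK : IsCompact K) (hK0 : volume K ≠ 0) {f : ℝ → ℝ} (hf : ContinuousOn f (Ici 0)) :
    ∫ x, f (randSymPolyVol n N (r • K) x) ∂jointUnif n N (r • K) =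
      ∫ x, f (randSymPolyVol n N K x) ∂jointUnif n N K := by
  have := isProbabilityMeasure_unifMeasure hK hK0
  have := isProbabilityMeasure_unifMeasure (hK.smul r) (by
    rw [Measure.addHaar_smul]
    exact mul_ne_zero (by simpa using pow_ne_zero _ hr) hK0)
  have hp : MeasurePreserving (fun (x : Fin N → ℰ) i => r • x i) (jointUnif n N K)
      (jointUnif n N (r • K)) :=
    measurePreserving_pi _ _ fun _ => measurePreserving_smul_unifMeasure hr K hK.measurableSet
  rw [← hp.map_eq, integral_map hp.measurable.aemeasurable
    (measurable_comp_randSymPolyVol hN _ hf).aestronglyMeasurable]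
  simp only [randSymPolyVol_smul hN hr]

end random

end

/-- Among all symmetric convex bodies `K` in `ℝⁿ`, the expectation `𝔼 f(V_{K,N})` of any
strictly increasing continuous `f : ℝ₊ → ℝ₊` applied to the normalized volume of a symmetric
random polytope on `N ≥ n` independent uniform points is minimized when `K` is the
Euclidean ball. -/
theorem expectation_f_randSymPolyVol_ge_ball
    (n N : ℕ) (hn : 0 < n) (hN : n ≤ N)
    (K : Set (EuclideanSpace ℝ (Fin n)))
    (hK_conv : Convex ℝ K) (hK_comp : IsCompact K)
    (hK_int : (interior K).Nonempty) (hK_symm : K = -K)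
    (f : ℝ → ℝ)
    (hf_mono : StrictMonoOn f (Set.Ici 0))
    (hf_cont : ContinuousOn f (Set.Ici 0))
    (hf_nonneg : ∀ t, 0 ≤ t → 0 ≤ f t) :
    ∫ x, f (randSymPolyVol n N K x) ∂(jointUnif n N K) ≥
      ∫ x, f (randSymPolyVol n N (Metric.closedBall (0 : EuclideanSpace ℝ (Fin n)) 1) x)
        ∂(jointUnif n N (Metric.closedBall (0 : EuclideanSpace ℝ (Fin n)) 1)) := by
  have hN0 : 0 < N := hn.trans_le hN
  have hKs : ∀ x ∈ K, -x ∈ K := fun x hx => by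
    rw [hK_symm] at hx
    exact hx
  have hK0 : volume K ≠ 0 := (Measure.measure_pos_of_nonempty_interior volume hK_int).ne'
  obtain ⟨r, hr, hvol, hle⟩ :=
    exists_closedBall_smallHullVolume_le hn N hK_conv hK_comp hKs hK0
  have hball : r • Metric.closedBall (0 : EuclideanSpace ℝ (Fin n)) 1 = Metric.closedBall 0 r := by
    rw [smul_unitClosedBall, Real.norm_of_nonneg hr.le]
  rw [ge_iff_le, ← integral_comp_randSymPolyVol_smul hN0 hr.ne' (isCompact_closedBall _ _)
    (Metric.measure_closedBall_pos volume _ one_pos).ne' hf_cont, hball]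
  exact integral_comp_randSymPolyVol_le_of_smallHullVolume_le hN0 hK_comp hK_conv hKs
    (isCompact_closedBall _ _) hK0 hvol hle hf_mono hf_cont hf_nonneg
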